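/- For any energy-admissible zero-error code of blocklength n on the noiseless binary two-way channel with energy exchange, with M₁ and M₂ uniform and independent, the sum rate satisfies log |M₁| + log |M₂| ≤ Σ_{k=1}^{n} H[(X_{1,k}, X_{2,k}) | U_{1,k}], where the entropies are Shannon entropies computed under the uniform probability measure on M₁ × M₂. -/

import Mathlib

/-!
Statement 1: Converse bound for the sum rate in the noiseless binary two-way
channel with energy exchange: for any energy-admissible zero-error code,
log |M₁| + log |M₂| ≤ Σ_{k=1}^{n} H[(X_{1,k}, X_{2,k}) | U_{1,k}],
entropies taken under the uniform measure on M₁ × M₂.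
-/

open Finset

/-- Probability that `X = v` under the uniform measure on a finite sample space `Ω`. -/
noncomputable def uprob {Ω V : Type*} [Fintype Ω] [DecidableEq V]
    (X : Ω → V) (v : V) : ℝ :=
  (Finset.univ.filter fun ω => X ω = v).card / (Fintype.card Ω : ℝ)

/-- Shannon entropy (natural log) of the random variable `X` under the uniform
measure on the finite sample space `Ω`. -/
noncomputable def uent {Ω V : Type*} [Fintype Ω] [DecidableEq V]
    (X : Ω → V) : ℝ :=
  ∑ v ∈ Finset.univ.image X, Real.negMulLog (uprob X v)

/-- Conditional Shannon entropy `H[X | Y] = H[(X,Y)] - H[Y]` under the uniform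
measure on the finite sample space `Ω`. -/
noncomputable def ucondEnt {Ω V W : Type*} [Fintype Ω] [DecidableEq V] [DecidableEq W]
    (X : Ω → V) (Y : Ω → W) : ℝ :=
  uent (fun ω => (X ω, Y ω)) - uent Y

section Entropy

variable {Ω V W S : Type*} [Fintype Ω] [DecidableEq V] [DecidableEq W] [DecidableEq S]

/-- The number of sample points on which `X` takes the same value as at `ω`. -/
def fiberCard (X : Ω → V) (ω : Ω) : ℕ :=
  (univ.filter fun ω' => X ω' = X ω).card

lemma fiberCard_pos (X : Ω → V) (ω : Ω) : 0 < fiberCard X ω :=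
  Finset.card_pos.mpr ⟨ω, by simp⟩

lemma fiberCard_congr {X : Ω → V} {Y : Ω → W} (h : ∀ ω ω', X ω = X ω' ↔ Y ω = Y ω') (ω : Ω) :
    fiberCard X ω = fiberCard Y ω := by
  simp only [fiberCard, h]

lemma uent_eq_log_card_sub [Nonempty Ω] (X : Ω → V) :
    uent X = Real.log (Fintype.card Ω) -
      (∑ ω, Real.log (fiberCard X ω)) / Fintype.card Ω := by
  have hN : (Fintype.card Ω : ℝ) ≠ 0 := by simp
  have hterm : ∀ v ∈ univ.image X, Real.negMulLog (uprob X v) =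
      ∑ ω with X ω = v,
        (Real.log (Fintype.card Ω) - Real.log (fiberCard X ω)) / Fintype.card Ω := by
    intro v hv
    obtain ⟨ω₀, -, rfl⟩ := mem_image.mp hv
    have hc : (fiberCard X ω₀ : ℝ) ≠ 0 := by exact_mod_cast (fiberCard_pos X ω₀).ne'
    have hcongr : ∀ ω ∈ univ.filter (fun ω => X ω = X ω₀),
        (Real.log (Fintype.card Ω) - Real.log (fiberCard X ω)) / (Fintype.card Ω : ℝ) =
        (Real.log (Fintype.card Ω) - Real.log (fiberCard X ω₀)) / Fintype.card Ω := by
      intro ω hω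
      simp only [fiberCard, (mem_filter.mp hω).2]
    rw [sum_congr rfl hcongr, sum_const, nsmul_eq_mul]
    change Real.negMulLog ((fiberCard X ω₀ : ℝ) / Fintype.card Ω) = (fiberCard X ω₀ : ℝ) * _
    rw [Real.negMulLog, Real.log_div hc hN]
    ring
  rw [uent, sum_congr rfl hterm,
    sum_fiberwise_of_maps_to (fun ω _ => mem_image_of_mem X (mem_univ ω)), ← sum_div,
    sum_sub_distrib, sum_const, card_univ, nsmul_eq_mul, sub_div, mul_div_cancel_left₀ _ hN]

lemma uent_congr [Nonempty Ω] {X : Ω → V} {Y : Ω → W}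
    (h : ∀ ω ω', X ω = X ω' ↔ Y ω = Y ω') : uent X = uent Y := by
  simp only [uent_eq_log_card_sub, fiberCard_congr h]

lemma uent_of_injective [Nonempty Ω] {X : Ω → V} (h : Function.Injective X) :
    uent X = Real.log (Fintype.card Ω) := by
  have hc (ω : Ω) : fiberCard X ω = 1 :=
    card_eq_one.mpr ⟨ω, by ext; simp [h.eq_iff]⟩
  simp [uent_eq_log_card_sub, hc]

lemma uent_of_subsingleton [Nonempty Ω] [Subsingleton V] (X : Ω → V) : uent X = 0 := by
  have hc (ω : Ω) : fiberCard X ω = Fintype.card Ω := by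
    rw [fiberCard, filter_true_of_mem fun _ _ => Subsingleton.elim _ _, card_univ]
  simp [uent_eq_log_card_sub, hc]

lemma sum_fiberCard_ratio_le {X : Ω → V} {Y : Ω → W} {Z : Ω → S}
    (h : ∀ ω ω', Y ω = Y ω' → Z ω = Z ω') :
    ∑ ω, (fiberCard Y ω * fiberCard (fun ω => (X ω, Z ω)) ω : ℝ) /
      (fiberCard (fun ω => (X ω, Y ω)) ω * fiberCard Z ω) ≤ Fintype.card Ω := by
  have hpos (ω : Ω) : (0 : ℝ) < fiberCard Z ω := by exact_mod_cast fiberCard_pos Z ω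
  have hfiber (ω₁ ω₂ : Ω) : ∑ ω with X ω = X ω₂ ∧ Y ω = Y ω₁,
      (1 : ℝ) / fiberCard (fun ω => (X ω, Y ω)) ω ≤ 1 := by
    have hcongr : ∀ ω ∈ univ.filter (fun ω => X ω = X ω₂ ∧ Y ω = Y ω₁),
        (1 : ℝ) / fiberCard (fun ω => (X ω, Y ω)) ω =
          1 / (univ.filter fun ω => X ω = X ω₂ ∧ Y ω = Y ω₁).card := by
      intro ω hω
      simp only [fiberCard, Prod.mk.injEq, (mem_filter.mp hω).2.1, (mem_filter.mp hω).2.2]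
    rw [sum_congr rfl hcongr, sum_const, nsmul_eq_mul, mul_one_div]
    exact div_self_le_one _
  have hinner (ω₁ : Ω) : ∑ ω with Y ω = Y ω₁,
      (fiberCard (fun ω => (X ω, Z ω)) ω : ℝ) / fiberCard (fun ω => (X ω, Y ω)) ω ≤
        fiberCard Z ω₁ := by
    calc _ = ∑ ω with Y ω = Y ω₁, ∑ ω₂ with (X ω₂, Z ω₂) = (X ω, Z ω),
          (1 : ℝ) / fiberCard (fun ω => (X ω, Y ω)) ω := by
          refine sum_congr rfl fun ω _ => ?_
          rw [sum_const, nsmul_eq_mul, mul_one_div]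
          rfl
      _ = ∑ ω₂ with Z ω₂ = Z ω₁, ∑ ω with X ω = X ω₂ ∧ Y ω = Y ω₁,
          (1 : ℝ) / fiberCard (fun ω => (X ω, Y ω)) ω := by
          refine sum_comm' fun ω ω₂ => ?_
          simp only [mem_filter, mem_univ, true_and, Prod.mk.injEq]
          constructor
          · rintro ⟨hY, hX, hZ⟩
            exact ⟨⟨hX.symm, hY⟩, hZ.trans (h _ _ hY)⟩
          · rintro ⟨⟨hX, hY⟩, hZ⟩
            exact ⟨hY, hX.symm, hZ.trans (h _ _ hY).symm⟩
      _ ≤ ∑ ω₂ with Z ω₂ = Z ω₁, (1 : ℝ) := sum_le_sum fun ω₂ _ => hfiber ω₁ ω₂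
      _ = fiberCard Z ω₁ := by simp [fiberCard]
  calc _ = ∑ ω, ∑ ω₁ with Y ω₁ = Y ω,
        ((fiberCard (fun ω => (X ω, Z ω)) ω : ℝ) / fiberCard (fun ω => (X ω, Y ω)) ω) /
          fiberCard Z ω₁ := by
        refine sum_congr rfl fun ω _ => ?_
        have hcongr : ∀ ω₁ ∈ univ.filter (fun ω₁ => Y ω₁ = Y ω),
            ((fiberCard (fun ω => (X ω, Z ω)) ω : ℝ) / fiberCard (fun ω => (X ω, Y ω)) ω) /
              fiberCard Z ω₁ =
            ((fiberCard (fun ω => (X ω, Z ω)) ω : ℝ) / fiberCard (fun ω => (X ω, Y ω)) ω) /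
              fiberCard Z ω := by
          intro ω₁ hω₁
          simp only [fiberCard, h _ _ (mem_filter.mp hω₁).2]
        rw [sum_congr rfl hcongr, sum_const, nsmul_eq_mul, div_div, mul_div_assoc]
        rfl
    _ = ∑ ω₁, ∑ ω with Y ω = Y ω₁,
        ((fiberCard (fun ω => (X ω, Z ω)) ω : ℝ) / fiberCard (fun ω => (X ω, Y ω)) ω) /
          fiberCard Z ω₁ := by
        refine sum_comm' fun ω ω₁ => ?_
        simp [eq_comm]
    _ ≤ ∑ _ω₁ : Ω, (1 : ℝ) := by
        refine sum_le_sum fun ω₁ _ => ?_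
        rw [← sum_div, div_le_one (hpos ω₁)]
        exact hinner ω₁
    _ = Fintype.card Ω := by simp

/-- Conditioning on a coarser random variable does not decrease the entropy. -/
lemma ucondEnt_le_of_factors [Nonempty Ω] {X : Ω → V} {Y : Ω → W} {Z : Ω → S}
    (h : ∀ ω ω', Y ω = Y ω' → Z ω = Z ω') : ucondEnt X Y ≤ ucondEnt X Z := by
  have hpoint (ω : Ω) :
      Real.log (fiberCard Y ω) + Real.log (fiberCard (fun ω => (X ω, Z ω)) ω) -
        (Real.log (fiberCard (fun ω => (X ω, Y ω)) ω) + Real.log (fiberCard Z ω)) ≤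
      (fiberCard Y ω * fiberCard (fun ω => (X ω, Z ω)) ω : ℝ) /
        (fiberCard (fun ω => (X ω, Y ω)) ω * fiberCard Z ω) - 1 := by
    have h₁ : (0 : ℝ) < fiberCard Y ω := by exact_mod_cast fiberCard_pos Y ω
    have h₂ : (0 : ℝ) < fiberCard (fun ω => (X ω, Z ω)) ω := by exact_mod_cast fiberCard_pos _ ω
    have h₃ : (0 : ℝ) < fiberCard (fun ω => (X ω, Y ω)) ω := by exact_mod_cast fiberCard_pos _ ω
    have h₄ : (0 : ℝ) < fiberCard Z ω := by exact_mod_cast fiberCard_pos Z ω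
    rw [← Real.log_mul h₁.ne' h₂.ne', ← Real.log_mul h₃.ne' h₄.ne',
      ← Real.log_div (by positivity) (by positivity)]
    exact Real.log_le_sub_one_of_pos (by positivity)
  have hsum := sum_le_sum fun ω (_ : ω ∈ univ) => hpoint ω
  simp only [sum_sub_distrib, sum_add_distrib, sum_const, card_univ, nsmul_eq_mul, mul_one]
    at hsum
  have hratio := sum_fiberCard_ratio_le (X := X) h
  have hN : (0 : ℝ) < Fintype.card Ω := by exact_mod_cast Fintype.card_pos
  have hdiv := div_le_div_of_nonneg_right (c := (Fintype.card Ω : ℝ))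
    (by linarith : (∑ ω, Real.log (fiberCard Y ω)) +
        ∑ ω, Real.log (fiberCard (fun ω => (X ω, Z ω)) ω) ≤
      (∑ ω, Real.log (fiberCard (fun ω => (X ω, Y ω)) ω)) + ∑ ω, Real.log (fiberCard Z ω)) hN.le
  rw [add_div, add_div] at hdiv
  simp only [ucondEnt, uent_eq_log_card_sub]
  linarith

/-- Chain rule: the entropy of the first `n` terms of a process is the sum of the entropies
of the terms given the past. -/
lemma uent_eq_sum_ucondEnt [Nonempty Ω] (X : Ω → ℕ → V) (n : ℕ) :
    uent (fun ω (i : Fin n) => X ω i) =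
      ∑ k ∈ range n, ucondEnt (fun ω => X ω k) (fun ω (i : Fin k) => X ω i) := by
  induction n with
  | zero => simpa using uent_of_subsingleton _
  | succ n ih =>
    rw [sum_range_succ, ← ih, ucondEnt, add_sub_cancel]
    refine uent_congr fun ω ω' => ?_
    simp [funext_iff, Fin.forall_fin_succ', and_comm]

end Entropy

/-- For deterministic interactive encoders, if two message pairs yield the same transcript,
then so does the pair that mixes them. -/
lemma transcript_mix {M₁ M₂ : Type*} {n : ℕ}
    {f1 : (k : ℕ) → M₁ → (Fin k → Bool) → Bool} {f2 : (k : ℕ) → M₂ → (Fin k → Bool) → Bool}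
    {X1 X2 : M₁ × M₂ → ℕ → Bool}
    (hX1 : ∀ ω : M₁ × M₂, ∀ k < n, X1 ω k = f1 k ω.1 (fun i : Fin k => X2 ω i))
    (hX2 : ∀ ω : M₁ × M₂, ∀ k < n, X2 ω k = f2 k ω.2 (fun i : Fin k => X1 ω i))
    {ω ω' : M₁ × M₂} (h : ∀ k < n, X1 ω k = X1 ω' k ∧ X2 ω k = X2 ω' k) (k : ℕ) (hk : k < n) :
    X1 (ω.1, ω'.2) k = X1 ω k ∧ X2 (ω.1, ω'.2) k = X2 ω k := by
  induction k using Nat.strong_induction_on with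
  | _ k ih =>
    have past (i : Fin k) := ih i i.2 (i.2.trans hk)
    constructor
    · rw [hX1 _ k hk, hX1 _ k hk]
      simp only [(past _).2]
    · rw [(h k hk).2, hX2 _ k hk, hX2 _ k hk]
      simp only [(past _).1, (h _ (Fin.is_lt _ |>.trans hk)).1]

/-- For any energy-admissible zero-error code of blocklength `n` on the noiseless
binary two-way channel with energy exchange (total energy `U`, initial state `u₁`),
with the messages uniform and independent, the rate of Node 1 satisfies
`log |M₁| + log |M₂| ≤ ∑_{k=0}^{n-1} H[(X₁ₖ, X₂ₖ) | U₁ₖ]` (channel uses indexed from 0). -/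
theorem sum_rate_outer_bound
    {M₁ M₂ : Type} [Fintype M₁] [Fintype M₂] [DecidableEq M₁] [DecidableEq M₂]
    [Nonempty M₁] [Nonempty M₂]
    (n U u₁ : ℕ) (hn : 1 ≤ n) (hU : 1 ≤ U) (hu₁ : u₁ ≤ U)
    -- encoders: at channel use k, a node maps its message and the past received
    -- symbols to the current transmitted symbol
    (f1 : (k : ℕ) → M₁ → (Fin k → Bool) → Bool)
    (f2 : (k : ℕ) → M₂ → (Fin k → Bool) → Bool)
    -- transmitted symbols and energy state of Node 1, as functions of the message pair
    (X1 X2 : M₁ × M₂ → ℕ → Bool) (U1 : M₁ × M₂ → ℕ → ℤ)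
    (hX1 : ∀ ω : M₁ × M₂, ∀ k < n, X1 ω k = f1 k ω.1 (fun i : Fin k => X2 ω i))
    (hX2 : ∀ ω : M₁ × M₂, ∀ k < n, X2 ω k = f2 k ω.2 (fun i : Fin k => X1 ω i))
    (hU0 : ∀ ω : M₁ × M₂, U1 ω 0 = (u₁ : ℤ))
    (hUrec : ∀ ω : M₁ × M₂, ∀ k < n,
      U1 ω (k + 1) = U1 ω k - (if X1 ω k then 1 else 0) + (if X2 ω k then 1 else 0))
    -- energy admissibility
    (hadm1 : ∀ ω : M₁ × M₂, ∀ k < n, U1 ω k = 0 → X1 ω k = false)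
    (hadm2 : ∀ ω : M₁ × M₂, ∀ k < n, U1 ω k = (U : ℤ) → X2 ω k = false)
    -- zero-error decodability at both nodes
    (hdec2 : ∃ g2 : M₂ → (Fin n → Bool) → M₁,
      ∀ ω : M₁ × M₂, g2 ω.2 (fun k : Fin n => X1 ω k) = ω.1)
    (hdec1 : ∃ g1 : M₁ → (Fin n → Bool) → M₂,
      ∀ ω : M₁ × M₂, g1 ω.1 (fun k : Fin n => X2 ω k) = ω.2) :
    Real.log (Fintype.card M₁ : ℝ) + Real.log (Fintype.card M₂ : ℝ) ≤
      ∑ k ∈ Finset.range n,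
        ucondEnt (fun ω => (X1 ω k, X2 ω k)) (fun ω => U1 ω k) := by
  have hinj : Function.Injective
      (fun (ω : M₁ × M₂) (i : Fin n) => (X1 ω i, X2 ω i)) := by
    intro ω ω' hωω'
    have h : ∀ k < n, X1 ω k = X1 ω' k ∧ X2 ω k = X2 ω' k := fun k hk => by
      simpa using congrFun hωω' ⟨k, hk⟩
    have hmix := transcript_mix hX1 hX2 h
    obtain ⟨g1, hg1⟩ := hdec1
    obtain ⟨g2, hg2⟩ := hdec2
    refine Prod.ext ?_ ?_
    · rw [← hg2 (ω.1, ω'.2), ← hg2 ω']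
      exact congrArg _ (funext fun i => (hmix i i.2).1.trans (h i i.2).1)
    · rw [← hg1 (ω.1, ω'.2), ← hg1 ω]
      exact congrArg _ (funext fun i => (hmix i i.2).2.symm)
  have hstate : ∀ k ≤ n, ∀ ω ω' : M₁ × M₂,
      (fun i : Fin k => (X1 ω i, X2 ω i)) = (fun i : Fin k => (X1 ω' i, X2 ω' i)) →
        U1 ω k = U1 ω' k := by
    intro k
    induction k with
    | zero => intro _ ω ω' _; rw [hU0, hU0]
    | succ k ih =>
      intro hk ω ω' h
      have hlast := congrFun h (Fin.last k)
      simp only [Fin.val_last, Prod.mk.injEq] at hlast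
      rw [hUrec ω k hk, hUrec ω' k hk, hlast.1, hlast.2,
        ih (Nat.le_of_succ_le hk) ω ω' (funext fun i => congrFun h i.castSucc)]
  have hcard : Real.log (Fintype.card M₁ : ℝ) + Real.log (Fintype.card M₂ : ℝ) =
      uent (fun (ω : M₁ × M₂) (i : Fin n) => (X1 ω i, X2 ω i)) := by
    rw [uent_of_injective hinj, Fintype.card_prod, Nat.cast_mul,
      Real.log_mul (by simp) (by simp)]
  rw [hcard, uent_eq_sum_ucondEnt (fun (ω : M₁ × M₂) k => (X1 ω k, X2 ω k))]
  exact sum_le_sum fun k hk => ucondEnt_le_of_factors (hstate k (mem_range.mp hk).le)
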